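/- arXiv:1903.10455 — 3 statements merged into one kernel-verified Lean document; each statement's English description precedes it below -/
import Mathlib

section
/- Let μ be a Borel probability measure on [0,1] whose support is not contained in {0,1}, let A₁, …, A_m be positive definite n×n complex matrices, and let w₁, …, w_m be positive reals with Σ_j w_j = 1. Then the function X ↦ Σ_{j=1}^m w_j φ_μ(A_j, X) attains a unique minimizer on the cone of positive definite n×n complex matrices. -/
open MeasureTheory Matrix
open scoped ComplexOrder

/-- `f_μ(x) = ∫_{[0,1]} x / ((1-λ)x + λ) dμ(λ)`. -/
noncomputable def fmu (μ : Measure ℝ) (x : ℝ) : ℝ := ∫ l, x / ((1 - l) * x + l) ∂μ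

/-- The center of mass `c(μ) = ∫_{[0,1]} λ dμ(λ)`. -/
noncomputable def cmu (μ : Measure ℝ) : ℝ := ∫ l, l ∂μ

/-- The positive square root of a positive definite matrix, via functional calculus. -/
noncomputable def matSqrt {n : ℕ} (A : Matrix (Fin n) (Fin n) ℂ) : Matrix (Fin n) (Fin n) ℂ :=
  cfc Real.sqrt A

/-- The Kubo–Ando mean `A σ_μ B = A^{1/2} f_μ(A^{-1/2} B A^{-1/2}) A^{1/2}`. -/
noncomputable def kuboAndo {n : ℕ} (μ : Measure ℝ) (A B : Matrix (Fin n) (Fin n) ℂ) :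
    Matrix (Fin n) (Fin n) ℂ :=
  matSqrt A * cfc (fmu μ) ((matSqrt A)⁻¹ * B * (matSqrt A)⁻¹) * matSqrt A

/-- The generalized quantum Hellinger divergence
`φ_μ(A,B) = Tr((1-c(μ))A + c(μ)B - A σ_μ B)`. -/
noncomputable def qhd {n : ℕ} (μ : Measure ℝ) (A B : Matrix (Fin n) (Fin n) ℂ) : ℝ :=
  (((1 - cmu μ) • A + cmu μ • B - kuboAndo μ A B).trace).re

namespace QHD

variable {n : ℕ} {A X Y N : Matrix (Fin n) (Fin n) ℂ} {l : ℝ}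

/-- The matrix `λA + (1-λ)X`. -/
noncomputable def pencil (l : ℝ) (A X : Matrix (Fin n) (Fin n) ℂ) : Matrix (Fin n) (Fin n) ℂ :=
  l • A + (1 - l) • X

/-- The integrand of the representation of `φ_μ(A, X)` as an integral over `λ`. -/
noncomputable def kern (l : ℝ) (A X : Matrix (Fin n) (Fin n) ℂ) : ℝ :=
  l * (1 - l) * ((X - A) * (pencil l A X)⁻¹ * (X - A)).trace.re

/-- An affine function of `X` lying below `kern l A`, parametrized by a matrix `N`. -/
noncomputable def minorant (l : ℝ) (A N X : Matrix (Fin n) (Fin n) ℂ) : ℝ :=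
  -(l * (1 - l)) * (Nᴴ * (X - A) + (X - A) * N + Nᴴ * pencil l A X * N).trace.re

/-- The matrix at which `minorant l A · X` attains its maximum `kern l A X`. -/
noncomputable def optimizer (l : ℝ) (A X : Matrix (Fin n) (Fin n) ℂ) :
    Matrix (Fin n) (Fin n) ℂ :=
  -((pencil l A X)⁻¹ * (X - A))

lemma posDef_smul {r : ℝ} (hr : 0 < r) (hA : A.PosDef) : (r • A).PosDef := hA.smul hr

lemma posSemidef_smul {r : ℝ} (hr : 0 ≤ r) (hA : A.PosSemidef) : (r • A).PosSemidef := hA.smul hr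

lemma pencil_posDef (hl : l ∈ Set.Ioo (0 : ℝ) 1) (hA : A.PosDef) (hX : X.PosSemidef) :
    (pencil l A X).PosDef :=
  (posDef_smul hl.1 hA).add_posSemidef (posSemidef_smul (by linarith [hl.2]) hX)

lemma isUnit_det_of_posDef (hA : A.PosDef) : IsUnit A.det :=
  (Matrix.isUnit_iff_isUnit_det A).1 hA.isUnit

lemma re_trace_nonneg (hA : A.PosSemidef) : 0 ≤ A.trace.re :=
  (Complex.le_def.1 hA.trace_nonneg).1

lemma re_trace_sandwich_pos (hA : A.PosDef) (hN : N ≠ 0) : 0 < (Nᴴ * A * N).trace.re := by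
  have hps := hA.posSemidef.conjTranspose_mul_mul_same N
  have h0 := hps.trace_nonneg
  refine lt_of_le_of_ne (re_trace_nonneg hps) fun h => hN ?_
  have htr : (Nᴴ * A * N).trace = 0 := by
    apply Complex.ext h.symm
    exact (Complex.le_def.1 h0).2.symm
  have hz := hps.trace_eq_zero_iff.1 htr
  by_contra hne
  obtain ⟨x, hx⟩ : ∃ x, N *ᵥ x ≠ 0 := by
    by_contra! hall
    exact hne (Matrix.ext_of_mulVec_single fun i => by rw [hall, zero_mulVec])
  have := hA.dotProduct_mulVec_pos hx
  rw [Matrix.star_mulVec, ← Matrix.dotProduct_mulVec, Matrix.mulVec_mulVec, Matrix.mulVec_mulVec,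
    hz] at this
  simp at this

lemma kern_sub_minorant (hD : (pencil l A X).PosDef) (hE : (X - A).IsHermitian) :
    kern l A X - minorant l A N X =
      l * (1 - l) * ((N - optimizer l A X)ᴴ * pencil l A X * (N - optimizer l A X)).trace.re := by
  have hu := isUnit_det_of_posDef hD
  have key : (N - optimizer l A X)ᴴ * pencil l A X * (N - optimizer l A X) =
      (X - A) * (pencil l A X)⁻¹ * (X - A) +
        (Nᴴ * (X - A) + (X - A) * N + Nᴴ * pencil l A X * N) := by
    unfold optimizer
    generalize pencil l A X = D at *
    generalize X - A = E at *
    have h1 : D⁻¹ᴴ = D⁻¹ := hD.inv.isHermitian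
    have h2 : Eᴴ = E := hE
    have h3 : D⁻¹ * D = 1 := Matrix.nonsing_inv_mul D hu
    have h4 : ∀ Z, D * (D⁻¹ * Z) = Z := fun Z => by
      rw [← Matrix.mul_assoc, Matrix.mul_nonsing_inv D hu, Matrix.one_mul]
    have h5 : ∀ Z, D⁻¹ * (D * Z) = Z := fun Z => by
      rw [← Matrix.mul_assoc, h3, Matrix.one_mul]
    simp only [sub_neg_eq_add, conjTranspose_add, conjTranspose_mul, h1, h2, add_mul, mul_add,
      Matrix.mul_assoc, h4, h5]
    abel
  rw [key, kern, minorant, trace_add ((X - A) * (pencil l A X)⁻¹ * (X - A)), Complex.add_re]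
  ring

lemma minorant_le_kern (hl : l ∈ Set.Ioo (0 : ℝ) 1) (hA : A.PosDef) (hX : X.PosSemidef)
    (N : Matrix (Fin n) (Fin n) ℂ) : minorant l A N X ≤ kern l A X := by
  have hD := pencil_posDef hl hA hX
  have h := kern_sub_minorant (N := N) hD (hX.isHermitian.sub hA.isHermitian)
  have := re_trace_nonneg (hD.posSemidef.conjTranspose_mul_mul_same (N - optimizer l A X))
  have := mul_nonneg (mul_nonneg hl.1.le (sub_nonneg.2 hl.2.le)) this
  linarith

lemma eq_optimizer_of_kern_le (hl : l ∈ Set.Ioo (0 : ℝ) 1) (hA : A.PosDef) (hX : X.PosSemidef)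
    (h : kern l A X ≤ minorant l A N X) : N = optimizer l A X := by
  by_contra hne
  have hD := pencil_posDef hl hA hX
  have h' := kern_sub_minorant (N := N) hD (hX.isHermitian.sub hA.isHermitian)
  have := re_trace_sandwich_pos hD (sub_ne_zero.2 hne)
  have := mul_pos (mul_pos hl.1 (sub_pos.2 hl.2)) this
  linarith

lemma minorant_optimizer (hl : l ∈ Set.Ioo (0 : ℝ) 1) (hA : A.PosDef) (hX : X.PosSemidef) :
    minorant l A (optimizer l A X) X = kern l A X := by
  have h := kern_sub_minorant (N := optimizer l A X) (pencil_posDef hl hA hX)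
    (hX.isHermitian.sub hA.isHermitian)
  simp at h
  linarith

lemma one_add_smul_optimizer (hD : (pencil l A X).PosDef) :
    1 + (1 - l) • optimizer l A X = (pencil l A X)⁻¹ * A := by
  have hu := isUnit_det_of_posDef hD
  have h : pencil l A X - (1 - l) • (X - A) = A := by unfold pencil; module
  calc 1 + (1 - l) • optimizer l A X
      = (pencil l A X)⁻¹ * (pencil l A X - (1 - l) • (X - A)) := by
        rw [mul_sub, Matrix.nonsing_inv_mul _ hu, optimizer, Matrix.mul_smul]
        module
    _ = (pencil l A X)⁻¹ * A := by rw [h]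

lemma minorant_midpoint :
    minorant l A N ((2⁻¹ : ℝ) • (X + Y)) = (minorant l A N X + minorant l A N Y) / 2 := by
  have h : Nᴴ * ((2⁻¹ : ℝ) • (X + Y) - A) + ((2⁻¹ : ℝ) • (X + Y) - A) * N +
        Nᴴ * pencil l A ((2⁻¹ : ℝ) • (X + Y)) * N =
      (2⁻¹ : ℝ) • ((Nᴴ * (X - A) + (X - A) * N + Nᴴ * pencil l A X * N) +
        (Nᴴ * (Y - A) + (Y - A) * N + Nᴴ * pencil l A Y * N)) := by
    simp only [pencil, mul_add, add_mul, mul_sub, sub_mul, smul_add, Matrix.mul_smul,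
      Matrix.smul_mul]
    module
  unfold minorant
  rw [h, trace_smul, trace_add, Complex.real_smul, Complex.re_ofReal_mul, Complex.add_re]
  ring

lemma optimizer_injective (hl : l ∈ Set.Ioo (0 : ℝ) 1) (hA : A.PosDef) (hX : X.PosSemidef)
    (hY : Y.PosSemidef) (h : optimizer l A X = optimizer l A Y) : X = Y := by
  have hDX := pencil_posDef hl hA hX
  have hDY := pencil_posDef hl hA hY
  have e := one_add_smul_optimizer hDX
  rw [h, one_add_smul_optimizer hDY] at e
  have hAu := isUnit_det_of_posDef hA
  have e2 : (pencil l A Y)⁻¹ = (pencil l A X)⁻¹ := by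
    have := congrArg (· * A⁻¹) e
    simpa [Matrix.mul_assoc, Matrix.mul_nonsing_inv A hAu] using this
  have e3 : pencil l A Y = pencil l A X := by
    rw [← Matrix.nonsing_inv_nonsing_inv _ (isUnit_det_of_posDef hDY), e2,
      Matrix.nonsing_inv_nonsing_inv _ (isUnit_det_of_posDef hDX)]
  have e4 : (1 - l) • X = (1 - l) • Y := (add_left_cancel e3).symm
  exact smul_right_injective _ (sub_pos.2 hl.2).ne' e4

lemma midpoint_posSemidef (hX : X.PosSemidef) (hY : Y.PosSemidef) :
    ((2⁻¹ : ℝ) • (X + Y)).PosSemidef :=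
  posSemidef_smul (by norm_num) (hX.add hY)

/-- `kern l A` is strictly convex on the positive semidefinite cone. -/
lemma kern_midpoint_lt (hl : l ∈ Set.Ioo (0 : ℝ) 1) (hA : A.PosDef) (hX : X.PosSemidef)
    (hY : Y.PosSemidef) (hne : X ≠ Y) :
    kern l A ((2⁻¹ : ℝ) • (X + Y)) < (kern l A X + kern l A Y) / 2 := by
  rw [← minorant_optimizer hl hA (midpoint_posSemidef hX hY), minorant_midpoint]
  set N := optimizer l A ((2⁻¹ : ℝ) • (X + Y))
  by_contra! h
  have hX' := minorant_le_kern hl hA hX N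
  have hY' := minorant_le_kern hl hA hY N
  refine hne (optimizer_injective hl hA hX hY ?_)
  rw [← eq_optimizer_of_kern_le (N := N) hl hA hX (by linarith),
    ← eq_optimizer_of_kern_le (N := N) hl hA hY (by linarith)]

lemma kern_nonneg (hl : l ∈ Set.Ioo (0 : ℝ) 1) (hA : A.PosDef) (hX : X.PosSemidef) :
    0 ≤ kern l A X := by
  simpa [minorant] using minorant_le_kern hl hA hX 0

lemma linear_le_kern (hl : l ∈ Set.Ioo (0 : ℝ) 1) (hA : A.PosDef) (hX : X.PosSemidef) :
    l * (1 - l) * (X.trace.re - 3 * A.trace.re) ≤ kern l A X := by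
  refine le_trans ?_ (minorant_le_kern hl hA hX (-1))
  have hx := re_trace_nonneg hX
  have ha := re_trace_nonneg hA.posSemidef
  have hp : 0 < l * (1 - l) := mul_pos hl.1 (sub_pos.2 hl.2)
  simp only [minorant, pencil, conjTranspose_neg, conjTranspose_one, neg_mul, one_mul, mul_neg,
    mul_one, neg_neg, trace_add, trace_neg, trace_sub, trace_smul, Complex.add_re, Complex.neg_re,
    Complex.sub_re, Complex.real_smul, Complex.re_ofReal_mul]
  rw [← mul_neg]
  refine mul_le_mul_of_nonneg_left ?_ hp.le
  nlinarith [hl.1, hl.2]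

lemma kern_le (hl : l ∈ Set.Ioo (0 : ℝ) 1) (hA : A.PosDef) (hX : X.PosSemidef) :
    kern l A X ≤ A.trace.re + X.trace.re := by
  have hx := re_trace_nonneg hX
  have ha := re_trace_nonneg hA.posSemidef
  rw [← minorant_optimizer hl hA hX, minorant]
  set N := optimizer l A X
  have key : (1 - l) • ((1 - l • N)ᴴ * A * (1 - l • N)) +
        l • ((1 + (1 - l) • N)ᴴ * X * (1 + (1 - l) • N)) =
      (1 - l) • A + l • X +
        (l * (1 - l)) • (Nᴴ * (X - A) + (X - A) * N + Nᴴ * pencil l A X * N) := by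
    simp only [pencil, conjTranspose_sub, conjTranspose_add, conjTranspose_smul, conjTranspose_one,
      star_trivial, mul_add, add_mul, mul_sub, sub_mul, smul_add, smul_sub, Matrix.mul_smul,
      Matrix.smul_mul, one_mul, mul_one]
    module
  have hnn := re_trace_nonneg
    ((posSemidef_smul (sub_nonneg.2 hl.2.le)
      (hA.posSemidef.conjTranspose_mul_mul_same (1 - l • N))).add
      (posSemidef_smul hl.1.le (hX.conjTranspose_mul_mul_same (1 + (1 - l) • N))))
  rw [key, trace_add, trace_add, trace_smul, trace_smul, trace_smul] at hnn
  simp only [Complex.add_re, Complex.real_smul, Complex.re_ofReal_mul] at hnn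
  nlinarith [hl.1, hl.2]

section Boundary

variable {v u : Fin n → ℂ} {t : ℝ}

lemma star_dotProduct_comm (x y : Fin n → ℂ) : star x ⬝ᵥ y = star (star y ⬝ᵥ x) := by
  rw [star_dotProduct]

lemma re_star_dotProduct_comm (x y : Fin n → ℂ) : (star x ⬝ᵥ y).re = (star y ⬝ᵥ x).re := by
  rw [star_dotProduct_comm x y]; rfl

lemma re_star_dotProduct_self_nonneg (x : Fin n → ℂ) : 0 ≤ (star x ⬝ᵥ x).re :=
  (Complex.le_def.1 (dotProduct_star_self_nonneg x)).1

lemma star_dotProduct_mulVec_comm (hA : A.IsHermitian) (x y : Fin n → ℂ) :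
    star x ⬝ᵥ A *ᵥ y = star (A *ᵥ x) ⬝ᵥ y := by
  rw [star_mulVec, ← dotProduct_mulVec, hA.eq]

/-- A Cauchy–Schwarz inequality for the form `⟨u, A u⟩`, with the square linearized. -/
lemma two_mul_sub_le_re_form (hA : A.PosDef) (s : ℝ) :
    2 * s * (star v ⬝ᵥ u).re - s ^ 2 * (star v ⬝ᵥ A⁻¹ *ᵥ v).re ≤ (star u ⬝ᵥ A *ᵥ u).re := by
  have hAv : A *ᵥ (A⁻¹ *ᵥ v) = v := by
    rw [mulVec_mulVec, Matrix.mul_nonsing_inv _ (isUnit_det_of_posDef hA), one_mulVec]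
  have h := (Complex.le_def.1 (hA.posSemidef.dotProduct_mulVec_nonneg (u - s • (A⁻¹ *ᵥ v)))).1
  have h1 : star (A⁻¹ *ᵥ v) ⬝ᵥ A *ᵥ u = star v ⬝ᵥ u := by
    rw [star_dotProduct_mulVec_comm hA.isHermitian, hAv]
  have h2 : star (A⁻¹ *ᵥ v) ⬝ᵥ v = star v ⬝ᵥ A⁻¹ *ᵥ v :=
    (star_dotProduct_mulVec_comm hA.inv.isHermitian v v).symm
  have h3 := re_star_dotProduct_comm u v
  simp only [mulVec_sub, mulVec_smul, hAv, star_sub, star_smul, star_trivial, sub_dotProduct,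
    dotProduct_sub, smul_dotProduct, dotProduct_smul, h1, h2, Complex.sub_re, Complex.real_smul,
    Complex.re_ofReal_mul, Complex.zero_re, h3] at h
  linarith

lemma one_lt_re_of_pencil_mulVec_eq (hl : l ∈ Set.Ioo (0 : ℝ) 1) (hA : A.PosDef)
    (hX : X.PosSemidef) (hXv : X *ᵥ v = 0) (hv : star v ⬝ᵥ v = 1) (ht : 0 < t)
    (htA : t * (star v ⬝ᵥ A⁻¹ *ᵥ v).re < 1)
    (hu : pencil l A (X + t • vecMulVec v (star v)) *ᵥ u = v) :
    1 < (star (A *ᵥ u) ⬝ᵥ A *ᵥ u).re := by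
  by_contra! hle
  have hDu : ∀ x : Fin n → ℂ, star x ⬝ᵥ v = l * (star x ⬝ᵥ A *ᵥ u) + (1 - l) *
      (star x ⬝ᵥ X *ᵥ u + t * ((star v ⬝ᵥ u) * (star x ⬝ᵥ v))) := fun x => by
    conv_lhs => rw [← hu]
    simp [pencil, add_mulVec, smul_mulVec, vecMulVec_mulVec, dotProduct_add, dotProduct_smul]
    ring
  have hXvu : star v ⬝ᵥ X *ᵥ u = 0 := by
    rw [star_dotProduct_mulVec_comm hX.isHermitian, hXv]; simp
  have e1 := congrArg Complex.re (hDu v)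
  have e2 := congrArg Complex.re (hDu u)
  rw [hXvu, hv] at e1
  have hsq : (star v ⬝ᵥ u) * (star u ⬝ᵥ v) = (Complex.normSq (star v ⬝ᵥ u) : ℂ) := by
    rw [star_dotProduct_comm u v, ← Complex.mul_conj]; rfl
  rw [hsq, re_star_dotProduct_comm u v] at e2
  rw [← Complex.ofReal_one, ← Complex.ofReal_sub] at e1 e2
  simp only [Complex.add_re, Complex.re_ofReal_mul, Complex.ofReal_re, zero_add, mul_one,
    Complex.ofReal_one, Complex.one_re] at e1 e2
  have hn : (star v ⬝ᵥ u).re ^ 2 ≤ Complex.normSq (star v ⬝ᵥ u) := by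
    rw [Complex.normSq_apply]; nlinarith [sq_nonneg (star v ⬝ᵥ u).im]
  have hX0 := (Complex.le_def.1 (hX.dotProduct_mulVec_nonneg u)).1
  have hcs := re_star_dotProduct_self_nonneg (v - A *ᵥ u)
  simp only [star_sub, sub_dotProduct, dotProduct_sub, Complex.sub_re, hv, Complex.one_re,
    re_star_dotProduct_comm (A *ᵥ u) v] at hcs
  set p := (star v ⬝ᵥ u).re
  have hA0 := two_mul_sub_le_re_form (v := v) (u := u) hA (t * p)
  obtain ⟨hl0, hl1⟩ := hl
  have hp : 1 ≤ t * p := by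
    by_contra! hlt
    nlinarith
  have hp0 : 0 < p := by
    by_contra! hneg
    nlinarith
  have hform : t * p ^ 2 < (star u ⬝ᵥ A *ᵥ u).re := by
    have : 0 < t * p ^ 2 * (1 - t * (star v ⬝ᵥ A⁻¹ *ᵥ v).re) :=
      mul_pos (by positivity) (by linarith)
    nlinarith
  have h1 : l * (t * p ^ 2) < l * (star u ⬝ᵥ A *ᵥ u).re := mul_lt_mul_of_pos_left hform hl0
  have h2 : (1 - l) * (t * p ^ 2) ≤ (1 - l) * ((star u ⬝ᵥ X *ᵥ u).re +
      t * Complex.normSq (star v ⬝ᵥ u)) := by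
    refine mul_le_mul_of_nonneg_left ?_ (by linarith)
    have := mul_le_mul_of_nonneg_left hn ht.le
    simp only [Complex.zero_re] at hX0
    linarith
  have h3 : p ≤ t * p ^ 2 := by nlinarith
  linarith

/-- Moving off the boundary of the cone along a kernel vector decreases `kern l A`. -/
lemma kern_add_vecMulVec_lt (hl : l ∈ Set.Ioo (0 : ℝ) 1) (hA : A.PosDef)
    (hX : X.PosSemidef) (hXv : X *ᵥ v = 0) (hv : star v ⬝ᵥ v = 1) (ht : 0 < t)
    (htA : t * (star v ⬝ᵥ A⁻¹ *ᵥ v).re < 1) :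
    kern l A (X + t • vecMulVec v (star v)) < kern l A X := by
  have hXt : (X + t • vecMulVec v (star v)).PosSemidef :=
    hX.add (posSemidef_smul ht.le (posSemidef_vecMulVec_self_star v))
  have hD := pencil_posDef hl hA hXt
  have hZ := one_add_smul_optimizer hD
  rw [← minorant_optimizer hl hA hXt]
  refine lt_of_lt_of_le ?_ (minorant_le_kern hl hA hX
    (optimizer l A (X + t • vecMulVec v (star v))))
  generalize optimizer l A (X + t • vecMulVec v (star v)) = N at *
  have key : (l * (1 - l)) • (Nᴴ * (X + t • vecMulVec v (star v) - A) +
        (X + t • vecMulVec v (star v) - A) * N +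
        Nᴴ * pencil l A (X + t • vecMulVec v (star v)) * N) =
      (l * (1 - l)) • (Nᴴ * (X - A) + (X - A) * N + Nᴴ * pencil l A X * N) +
      (l * t) • ((1 + (1 - l) • N)ᴴ * vecMulVec v (star v) * (1 + (1 - l) • N) -
        vecMulVec v (star v)) := by
    generalize vecMulVec v (star v) = H
    simp only [pencil, conjTranspose_add, conjTranspose_smul, conjTranspose_one,
      star_trivial, mul_add, add_mul, mul_sub, sub_mul, smul_add, Matrix.mul_smul,
      Matrix.smul_mul, one_mul, mul_one]
    module
  set D := pencil l A (X + t • vecMulVec v (star v))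
  have hu : D *ᵥ (D⁻¹ *ᵥ v) = v := by
    rw [mulVec_mulVec, Matrix.mul_nonsing_inv _ (isUnit_det_of_posDef hD), one_mulVec]
  have hlt := one_lt_re_of_pencil_mulVec_eq hl hA hX hXv hv ht htA hu
  have hv' : v ⬝ᵥ star v = 1 := by rw [dotProduct_comm, hv]
  have htr : ((D⁻¹ * A)ᴴ * vecMulVec v (star v) * (D⁻¹ * A)).trace =
      star (A *ᵥ D⁻¹ *ᵥ v) ⬝ᵥ A *ᵥ D⁻¹ *ᵥ v := by
    have hw : A *ᵥ D⁻¹ *ᵥ v = (D⁻¹ * A)ᴴ *ᵥ v := by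
      rw [conjTranspose_mul, hA.isHermitian.eq, hD.inv.isHermitian.eq, mulVec_mulVec]
    rw [hw, mul_vecMulVec, vecMulVec_mul, trace_vecMulVec, dotProduct_comm, star_mulVec,
      conjTranspose_conjTranspose]
  have := congrArg (fun M => M.trace.re) key
  simp only [trace_add _ ((l * t) • _), trace_smul, trace_sub, Complex.add_re, Complex.real_smul,
    Complex.re_ofReal_mul] at this
  rw [hZ, Complex.sub_re, htr, trace_vecMulVec, hv', Complex.one_re] at this
  unfold minorant
  nlinarith [mul_pos (mul_pos hl.1 ht) (sub_pos.2 hlt)]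

lemma exists_unit_ker_of_not_posDef (hX : X.PosSemidef) (h : ¬ X.PosDef) :
    ∃ v : Fin n → ℂ, star v ⬝ᵥ v = 1 ∧ X *ᵥ v = 0 := by
  obtain ⟨v, hv, hXv⟩ := Matrix.exists_mulVec_eq_zero_iff.2
    (not_not.1 fun hd => h (hX.posDef_iff_det_ne_zero.2 hd))
  have hpos := dotProduct_star_self_pos_iff.2 hv
  obtain ⟨hre, him⟩ := Complex.lt_def.1 hpos
  simp only [Complex.zero_re, Complex.zero_im] at hre him
  set r := (star v ⬝ᵥ v).re with hr
  have hrv : star v ⬝ᵥ v = (r : ℂ) := Complex.ext rfl him.symm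
  refine ⟨(Real.sqrt r)⁻¹ • v, ?_, by rw [mulVec_smul, hXv, smul_zero]⟩
  rw [star_smul, smul_dotProduct, dotProduct_smul, hrv, star_trivial, smul_smul,
    Complex.real_smul, ← Complex.ofReal_mul, ← mul_inv, Real.mul_self_sqrt hre.le,
    inv_mul_cancel₀ hre.ne', Complex.ofReal_one]

end Boundary

section Continuity

lemma continuousOn_matrix_inv {T : Type*} [TopologicalSpace T] {f : T → Matrix (Fin n) (Fin n) ℂ}
    {s : Set T} (hf : ContinuousOn f s) (h : ∀ x ∈ s, IsUnit (f x).det) :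
    ContinuousOn (fun x => (f x)⁻¹) s := by
  simp only [Matrix.inv_def, Ring.inverse_eq_inv']
  exact ((continuous_id.matrix_det.comp_continuousOn hf).inv₀ fun x hx => (h x hx).ne_zero).smul
    (continuous_id.matrix_adjugate.comp_continuousOn hf)

lemma continuousOn_kern_left (hA : A.PosDef) (hX : X.PosSemidef) :
    ContinuousOn (fun l => kern l A X) (Set.Ioo (0 : ℝ) 1) := by
  have hp : ContinuousOn (fun l => pencil l A X) (Set.Ioo (0 : ℝ) 1) :=
    Continuous.continuousOn (by unfold pencil; fun_prop)
  have hi := continuousOn_matrix_inv hp fun l hl => isUnit_det_of_posDef (pencil_posDef hl hA hX)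
  refine ContinuousOn.mul (by fun_prop) (Complex.continuous_re.comp_continuousOn ?_)
  exact continuous_id.matrix_trace.comp_continuousOn
    ((continuousOn_const.mul hi).mul continuousOn_const)

lemma continuousOn_kern_right (hl : l ∈ Set.Ioo (0 : ℝ) 1) (hA : A.PosDef) :
    ContinuousOn (fun X => kern l A X) {X | X.PosSemidef} := by
  have hp : ContinuousOn (fun X => pencil l A X) {X | X.PosSemidef} :=
    Continuous.continuousOn (by unfold pencil; fun_prop)
  have hi := continuousOn_matrix_inv hp fun X hX => isUnit_det_of_posDef (pencil_posDef hl hA hX)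
  refine ContinuousOn.mul (by fun_prop) (Complex.continuous_re.comp_continuousOn ?_)
  have hs : ContinuousOn (fun X : Matrix (Fin n) (Fin n) ℂ => X - A) {X | X.PosSemidef} := by
    fun_prop
  exact continuous_id.matrix_trace.comp_continuousOn ((hs.mul hi).mul hs)

open scoped MatrixOrder in
lemma exists_eq_conjTranspose_mul_self (hX : X.PosSemidef) :
    ∃ B : Matrix (Fin n) (Fin n) ℂ, X = Bᴴ * B :=
  CStarAlgebra.nonneg_iff_eq_star_mul_self.1 hX.nonneg

lemma isCompact_posSemidef_trace_le (R : ℝ) :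
    IsCompact {X : Matrix (Fin n) (Fin n) ℂ | X.PosSemidef ∧ X.trace.re ≤ R} := by
  have htr : ∀ B : Matrix (Fin n) (Fin n) ℂ, (Bᴴ * B).trace.re = ∑ i, ∑ j, ‖B j i‖ ^ 2 := by
    intro B
    simp only [trace, diag_apply, mul_apply, conjTranspose_apply, Complex.re_sum]
    refine Finset.sum_congr rfl fun i _ => Finset.sum_congr rfl fun j _ => ?_
    rw [mul_comm, ← Complex.normSq_eq_norm_sq, ← Complex.ofReal_re (Complex.normSq _),
      ← Complex.mul_conj]
    rfl
  have hcont : Continuous fun B : Matrix (Fin n) (Fin n) ℂ => Bᴴ * B := by fun_prop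
  have hS : IsCompact {B : Matrix (Fin n) (Fin n) ℂ | (Bᴴ * B).trace.re ≤ R} := by
    refine IsCompact.of_isClosed_subset
      (isCompact_univ_pi fun _ : Fin n => isCompact_univ_pi fun _ : Fin n =>
        isCompact_closedBall (0 : ℂ) (R + 1)) ?_ ?_
    · exact isClosed_le (Complex.continuous_re.comp hcont.matrix_trace) continuous_const
    · intro B hB i _ j _
      rw [Set.mem_ofPred_eq, htr] at hB
      have h1 : ‖B i j‖ ^ 2 ≤ ∑ i, ‖B i j‖ ^ 2 :=
        Finset.single_le_sum (f := fun i => ‖B i j‖ ^ 2) (fun _ _ => by positivity)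
          (Finset.mem_univ i)
      have h2 : ∑ i, ‖B i j‖ ^ 2 ≤ ∑ j, ∑ i, ‖B i j‖ ^ 2 :=
        Finset.single_le_sum (f := fun j => ∑ i, ‖B i j‖ ^ 2) (fun _ _ => by positivity)
          (Finset.mem_univ j)
      rw [mem_closedBall_zero_iff]
      nlinarith [sq_nonneg (‖B i j‖ - 1)]
  convert hS.image hcont using 1
  ext X
  constructor
  · rintro ⟨hX, hR⟩
    obtain ⟨B, rfl⟩ := exists_eq_conjTranspose_mul_self hX
    exact ⟨B, hR, rfl⟩
  · rintro ⟨B, hB, rfl⟩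
    exact ⟨posSemidef_conjTranspose_mul_self B, hB⟩

end Continuity

section Representation

variable {μ : Measure ℝ} {y : ℝ}

lemma ae_mem_Icc [IsProbabilityMeasure μ] (h : μ (Set.Icc (0 : ℝ) 1) = 1) :
    ∀ᵐ l ∂μ, l ∈ Set.Icc (0 : ℝ) 1 :=
  (prob_compl_eq_zero_iff measurableSet_Icc).2 h

lemma denominator_pos (hy : 0 < y) (hl : l ∈ Set.Icc (0 : ℝ) 1) : 0 < (1 - l) * y + l := by
  obtain ⟨h0, h1⟩ := hl
  rcases h0.eq_or_lt with rfl | h0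
  · simpa using hy
  · exact add_pos_of_nonneg_of_pos (mul_nonneg (sub_nonneg.2 h1) hy.le) h0

lemma integrable_fmu [IsProbabilityMeasure μ] (h : μ (Set.Icc (0 : ℝ) 1) = 1) (hy : 0 < y) :
    Integrable (fun l => y / ((1 - l) * y + l)) μ := by
  refine Integrable.of_bound (C := 1 + y)
    (by fun_prop : Measurable fun l : ℝ => y / ((1 - l) * y + l)).aestronglyMeasurable ?_
  filter_upwards [ae_mem_Icc h] with l hl
  have hd := denominator_pos hy hl
  rw [Real.norm_of_nonneg (by positivity), div_le_iff₀ hd]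
  nlinarith [mul_nonneg (sub_nonneg.2 hl.2) (sq_nonneg y), hl.1]

lemma integrable_id_of_Icc [IsProbabilityMeasure μ] (h : μ (Set.Icc (0 : ℝ) 1) = 1) :
    Integrable (fun l : ℝ => l) μ := by
  refine Integrable.of_bound (C := 1) measurable_id.aestronglyMeasurable ?_
  filter_upwards [ae_mem_Icc h] with l hl
  rw [Real.norm_of_nonneg hl.1]
  exact hl.2

lemma scalar_integrand_eq (hy : 0 < y) (hl : l ∈ Set.Icc (0 : ℝ) 1) :
    1 - l + l * y - y / ((1 - l) * y + l) =
      l * (1 - l) * ((y - 1) ^ 2 / ((1 - l) * y + l)) := by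
  have hd := (denominator_pos hy hl).ne'
  field_simp
  ring

lemma integrable_scalar_integrand [IsProbabilityMeasure μ] (h : μ (Set.Icc (0 : ℝ) 1) = 1)
    (hy : 0 < y) :
    Integrable (fun l => l * (1 - l) * ((y - 1) ^ 2 / ((1 - l) * y + l))) μ := by
  have hid := integrable_id_of_Icc h
  refine ((((integrable_const 1).sub hid).add (hid.mul_const y)).sub
    (integrable_fmu h hy)).congr ?_
  filter_upwards [ae_mem_Icc h] with l hl
  exact scalar_integrand_eq hy hl

lemma integral_scalar_integrand [IsProbabilityMeasure μ] (h : μ (Set.Icc (0 : ℝ) 1) = 1)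
    (hy : 0 < y) :
    ∫ l, l * (1 - l) * ((y - 1) ^ 2 / ((1 - l) * y + l)) ∂μ =
      1 - cmu μ + cmu μ * y - fmu μ y := by
  have hid := integrable_id_of_Icc h
  have hc := integrable_const (μ := μ) (1 : ℝ)
  have : ∀ᵐ l ∂μ, l * (1 - l) * ((y - 1) ^ 2 / ((1 - l) * y + l)) =
      1 - l + l * y - y / ((1 - l) * y + l) := by
    filter_upwards [ae_mem_Icc h] with l hl
    exact (scalar_integrand_eq hy hl).symm
  have h1 : Integrable (fun l : ℝ => 1 - l) μ := hc.sub hid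
  have h2 : Integrable (fun l : ℝ => 1 - l + l * y) μ := h1.add (hid.mul_const y)
  rw [integral_congr_ae this, integral_sub h2 (integrable_fmu h hy),
    integral_add h1 (hid.mul_const y), integral_sub hc hid, integral_mul_const]
  simp [cmu, fmu]

lemma trace_mul_diagonal_mul_conjTranspose (P : Matrix (Fin n) (Fin n) ℂ) (d : Fin n → ℝ) :
    (P * diagonal (fun i => (d i : ℂ)) * Pᴴ).trace.re = ∑ i, d i * ((Pᴴ * P) i i).re := by
  rw [Matrix.mul_assoc, trace_mul_comm, Matrix.mul_assoc, trace]
  simp [diagonal_mul]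

lemma pencil_conj_diagonal (P : Matrix (Fin n) (Fin n) ℂ) (d : Fin n → ℝ) :
    pencil l (P * Pᴴ) (P * diagonal (fun i => (d i : ℂ)) * Pᴴ) =
      P * diagonal (fun i => (((1 - l) * d i + l : ℝ) : ℂ)) * Pᴴ := by
  have h : diagonal (fun i => (((1 - l) * d i + l : ℝ) : ℂ)) =
      (1 - l) • diagonal (fun i => (d i : ℂ)) + l • (1 : Matrix (Fin n) (Fin n) ℂ) := by
    rw [← diagonal_one, ← diagonal_smul, ← diagonal_smul, diagonal_add]
    congr 1
    ext i
    simp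
  rw [h, pencil, Matrix.mul_add, Matrix.add_mul, Matrix.mul_smul, Matrix.mul_smul,
    Matrix.smul_mul, Matrix.smul_mul, Matrix.mul_one, add_comm]

lemma kern_conj_diagonal {P : Matrix (Fin n) (Fin n) ℂ} (hP : IsUnit P.det) {d : Fin n → ℝ}
    (hd : ∀ i, 0 < d i) (hl : l ∈ Set.Icc (0 : ℝ) 1) :
    kern l (P * Pᴴ) (P * diagonal (fun i => (d i : ℂ)) * Pᴴ) =
      ∑ i, l * (1 - l) * ((d i - 1) ^ 2 / ((1 - l) * d i + l)) * ((Pᴴ * P) i i).re := by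
  have hPH : IsUnit Pᴴ.det := by rw [det_conjTranspose]; exact hP.star
  have hsub : P * diagonal (fun i => (d i : ℂ)) * Pᴴ - P * Pᴴ =
      P * diagonal (fun i => ((d i - 1 : ℝ) : ℂ)) * Pᴴ := by
    have h : diagonal (fun i => ((d i - 1 : ℝ) : ℂ)) =
        diagonal (fun i => (d i : ℂ)) - (1 : Matrix (Fin n) (Fin n) ℂ) := by
      rw [← diagonal_one, diagonal_sub]
      simp
    rw [h, Matrix.mul_sub, Matrix.sub_mul, Matrix.mul_one]
  have hinv : (diagonal (fun i => (((1 - l) * d i + l : ℝ) : ℂ)))⁻¹ =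
      diagonal (fun i => ((((1 - l) * d i + l)⁻¹ : ℝ) : ℂ)) := by
    refine Matrix.inv_eq_right_inv ?_
    rw [diagonal_mul_diagonal, ← diagonal_one]
    congr 1
    ext i
    rw [← Complex.ofReal_mul, mul_inv_cancel₀ (denominator_pos (hd i) hl).ne',
      Complex.ofReal_one]
  have h1 : ∀ Z, Pᴴ * (Pᴴ⁻¹ * Z) = Z := fun Z => by
    rw [← Matrix.mul_assoc, Matrix.mul_nonsing_inv _ hPH, Matrix.one_mul]
  have h2 : ∀ Z, P⁻¹ * (P * Z) = Z := fun Z => by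
    rw [← Matrix.mul_assoc, Matrix.nonsing_inv_mul _ hP, Matrix.one_mul]
  have hprod : P * diagonal (fun i => ((d i - 1 : ℝ) : ℂ)) * Pᴴ *
        (P * diagonal (fun i => (((1 - l) * d i + l : ℝ) : ℂ)) * Pᴴ)⁻¹ *
        (P * diagonal (fun i => ((d i - 1 : ℝ) : ℂ)) * Pᴴ) =
      P * diagonal (fun i => (((d i - 1) ^ 2 / ((1 - l) * d i + l) : ℝ) : ℂ)) * Pᴴ := by
    rw [Matrix.mul_inv_rev, Matrix.mul_inv_rev, hinv]
    simp only [Matrix.mul_assoc, h1, h2]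
    rw [← Matrix.mul_assoc (diagonal _) (diagonal _) Pᴴ, diagonal_mul_diagonal,
      ← Matrix.mul_assoc (diagonal _) (diagonal _) Pᴴ, diagonal_mul_diagonal]
    congr 3
    ext i
    push_cast
    ring
  rw [kern, pencil_conj_diagonal, hsub, hprod, trace_mul_diagonal_mul_conjTranspose,
    Finset.mul_sum]
  simp only [mul_assoc]

lemma matSqrt_mul_self (hA : A.PosSemidef) : matSqrt A * matSqrt A = A := by
  have hc : ContinuousOn Real.sqrt (spectrum ℝ A) := Real.continuous_sqrt.continuousOn
  have hsa : IsSelfAdjoint A := hA.isHermitian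
  rw [matSqrt, ← cfc_mul _ _ A hc hc]
  conv_rhs => rw [← cfc_id ℝ A]
  refine cfc_congr fun x hx => ?_
  rw [hA.isHermitian.spectrum_real_eq_range_eigenvalues] at hx
  obtain ⟨i, rfl⟩ := hx
  exact Real.mul_self_sqrt (hA.eigenvalues_nonneg i)

lemma matSqrt_isHermitian : (matSqrt A).IsHermitian := cfc_predicate _ A

lemma exists_unitary_diagonal (hA : A.PosDef) :
    ∃ (U : Matrix (Fin n) (Fin n) ℂ) (d : Fin n → ℝ), U * Uᴴ = 1 ∧ (∀ i, 0 < d i) ∧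
      A = U * diagonal (fun i => (d i : ℂ)) * Uᴴ ∧
      ∀ f : ℝ → ℝ, cfc f A = U * diagonal (fun i => (f (d i) : ℂ)) * Uᴴ :=
  ⟨hA.isHermitian.eigenvectorUnitary, hA.isHermitian.eigenvalues,
    Unitary.coe_mul_star_self _, hA.eigenvalues_pos, hA.isHermitian.spectral_theorem,
    fun f => hA.isHermitian.cfc_eq f⟩

/-- Simultaneous diagonalization of `A` and `X` by congruence, compatible with `kuboAndo`. -/
lemma exists_conj_diagonal (hA : A.PosDef) (hX : X.PosDef) :
    ∃ (P : Matrix (Fin n) (Fin n) ℂ) (d : Fin n → ℝ), IsUnit P.det ∧ (∀ i, 0 < d i) ∧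
      A = P * Pᴴ ∧ X = P * diagonal (fun i => (d i : ℂ)) * Pᴴ ∧
      ∀ μ : Measure ℝ, kuboAndo μ A X = P * diagonal (fun i => (fmu μ (d i) : ℂ)) * Pᴴ := by
  have hSS := matSqrt_mul_self hA.posSemidef
  have hSH : (matSqrt A)ᴴ = matSqrt A := matSqrt_isHermitian
  have hSu : IsUnit (matSqrt A).det := by
    have := isUnit_det_of_posDef hA
    rw [← hSS, det_mul] at this
    exact isUnit_of_mul_isUnit_left this
  unfold kuboAndo
  generalize matSqrt A = S at *
  have hSi : (S⁻¹)ᴴ = S⁻¹ := by rw [conjTranspose_nonsing_inv, hSH]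
  have hY : (S⁻¹ * X * S⁻¹).PosDef := by
    have hu : IsUnit S⁻¹ := (Matrix.isUnit_iff_isUnit_det _).2 (Matrix.isUnit_nonsing_inv_det S hSu)
    have := (Matrix.IsUnit.posDef_star_left_conjugate_iff hu).2 hX
    rwa [star_eq_conjTranspose, hSi] at this
  obtain ⟨U, d, hU, hd, hspec, hcfc⟩ := exists_unitary_diagonal hY
  refine ⟨S * U, d, ?_, hd, ?_, ?_, fun μ => ?_⟩
  · rw [det_mul]
    exact hSu.mul (IsUnit.of_mul_eq_one _ (by rw [← det_mul, hU, det_one]))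
  · rw [conjTranspose_mul, Matrix.mul_assoc, ← Matrix.mul_assoc U, hU, Matrix.one_mul, hSH, hSS]
  · have hXe : X = S * (S⁻¹ * X * S⁻¹) * S := by
      simp only [Matrix.mul_assoc, Matrix.nonsing_inv_mul S hSu, Matrix.mul_one]
      rw [← Matrix.mul_assoc, Matrix.mul_nonsing_inv S hSu, Matrix.one_mul]
    conv_lhs => rw [hXe, hspec]
    rw [conjTranspose_mul, hSH]
    simp only [Matrix.mul_assoc]
  · rw [hcfc, conjTranspose_mul, hSH]
    simp only [Matrix.mul_assoc]

/-- The divergence `φ_μ(A, X)` as an integral of `kern` over the open unit interval. -/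
lemma qhd_eq_integral_kern [IsProbabilityMeasure μ] (h : μ (Set.Icc (0 : ℝ) 1) = 1)
    (hA : A.PosDef) (hX : X.PosDef) :
    qhd μ A X = ∫ l, kern l A X ∂(μ.restrict (Set.Ioo 0 1)) := by
  obtain ⟨P, d, hP, hd, hAP, hXP, hK⟩ := exists_conj_diagonal hA hX
  have hrestrict : ∫ l, kern l A X ∂(μ.restrict (Set.Ioo 0 1)) = ∫ l, kern l A X ∂μ := by
    refine setIntegral_eq_integral_of_ae_compl_eq_zero ?_
    filter_upwards [ae_mem_Icc h] with l hl hl'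
    have : l = 0 ∨ l = 1 := by
      by_contra! hne
      exact hl' ⟨lt_of_le_of_ne hl.1 hne.1.symm, lt_of_le_of_ne hl.2 hne.2⟩
    rcases this with rfl | rfl <;> simp [kern]
  have hkern : ∀ᵐ l ∂μ, kern l A X =
      ∑ i, l * (1 - l) * ((d i - 1) ^ 2 / ((1 - l) * d i + l)) * ((Pᴴ * P) i i).re := by
    filter_upwards [ae_mem_Icc h] with l hl
    rw [hAP, hXP, kern_conj_diagonal hP hd hl]
  rw [hrestrict, integral_congr_ae hkern,
    integral_finsetSum _ fun i _ => (integrable_scalar_integrand h (hd i)).mul_const _]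
  simp only [integral_mul_const, integral_scalar_integrand h (hd _)]
  have hA1 : A.trace.re = ∑ i, ((Pᴴ * P) i i).re := by
    rw [hAP, trace_mul_comm, trace, Complex.re_sum]
    rfl
  have hX1 : X.trace.re = ∑ i, d i * ((Pᴴ * P) i i).re := by
    rw [← trace_mul_diagonal_mul_conjTranspose, ← hXP]
  have hK1 : (kuboAndo μ A X).trace.re = ∑ i, fmu μ (d i) * ((Pᴴ * P) i i).re := by
    rw [hK, trace_mul_diagonal_mul_conjTranspose]
  rw [qhd, trace_sub, trace_add, trace_smul, trace_smul, Complex.sub_re, Complex.add_re,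
    Complex.real_smul, Complex.real_smul, Complex.re_ofReal_mul, Complex.re_ofReal_mul, hA1, hX1,
    hK1, Finset.mul_sum, Finset.mul_sum, ← Finset.sum_add_distrib, ← Finset.sum_sub_distrib]
  exact Finset.sum_congr rfl fun i _ => by ring

end Representation

section Energy

variable {m : ℕ} {ν : Measure ℝ} {B : Fin m → Matrix (Fin n) (Fin n) ℂ} {w : Fin m → ℝ}

/-- The weighted sum of the divergences from the matrices `B j`, as a function on the closed
positive semidefinite cone. -/
noncomputable def energy (ν : Measure ℝ) (B : Fin m → Matrix (Fin n) (Fin n) ℂ) (w : Fin m → ℝ)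
    (X : Matrix (Fin n) (Fin n) ℂ) : ℝ :=
  ∑ j, w j * ∫ l, kern l (B j) X ∂ν

lemma aestronglyMeasurable_kern (hν : ∀ᵐ l ∂ν, l ∈ Set.Ioo (0 : ℝ) 1) (hA : A.PosDef)
    (hX : X.PosSemidef) : AEStronglyMeasurable (fun l => kern l A X) ν := by
  rw [← Measure.restrict_eq_self_of_ae_mem hν]
  exact (continuousOn_kern_left hA hX).aestronglyMeasurable measurableSet_Ioo

lemma norm_kern_le (hl : l ∈ Set.Ioo (0 : ℝ) 1) (hA : A.PosDef) (hX : X.PosSemidef) :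
    ‖kern l A X‖ ≤ A.trace.re + X.trace.re := by
  rw [Real.norm_of_nonneg (kern_nonneg hl hA hX)]
  exact kern_le hl hA hX

lemma integrable_kern [IsFiniteMeasure ν] (hν : ∀ᵐ l ∂ν, l ∈ Set.Ioo (0 : ℝ) 1) (hA : A.PosDef)
    (hX : X.PosSemidef) : Integrable (fun l => kern l A X) ν :=
  Integrable.of_bound (aestronglyMeasurable_kern hν hA hX) (A.trace.re + X.trace.re)
    (hν.mono fun _ hl => norm_kern_le hl hA hX)

lemma continuousOn_energy [IsFiniteMeasure ν] (hν : ∀ᵐ l ∂ν, l ∈ Set.Ioo (0 : ℝ) 1)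
    (hB : ∀ j, (B j).PosDef) (R : ℝ) :
    ContinuousOn (energy ν B w) {X | X.PosSemidef ∧ X.trace.re ≤ R} := by
  have : FirstCountableTopology (Matrix (Fin n) (Fin n) ℂ) :=
    inferInstanceAs (FirstCountableTopology (Fin n → Fin n → ℂ))
  refine continuousOn_finsetSum _ fun j _ => continuousOn_const.mul ?_
  refine continuousOn_of_dominated (bound := fun _ => (B j).trace.re + R)
    (fun X hX => aestronglyMeasurable_kern hν (hB j) hX.1) (fun X hX => ?_)
    (integrable_const _) ?_
  · filter_upwards [hν] with l hl
    exact (norm_kern_le hl (hB j) hX.1).trans (add_le_add_right hX.2 _)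
  · filter_upwards [hν] with l hl
    exact (continuousOn_kern_right hl (hB j)).mono fun X hX => hX.1

lemma integral_lt_integral_of_forall_Ioo (hν : ∀ᵐ l ∂ν, l ∈ Set.Ioo (0 : ℝ) 1) (hν0 : ν ≠ 0)
    {f g : ℝ → ℝ} (hf : Integrable f ν) (hg : Integrable g ν)
    (h : ∀ l ∈ Set.Ioo (0 : ℝ) 1, f l < g l) : ∫ l, f l ∂ν < ∫ l, g l ∂ν := by
  have hae : ∀ᵐ l ∂ν, 0 < g l - f l := hν.mono fun l hl => sub_pos.2 (h l hl)
  have hpos : 0 < ∫ l, (g l - f l) ∂ν := by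
    rw [integral_pos_iff_support_of_nonneg_ae (hae.mono fun l hl => hl.le) (hg.sub hf)]
    refine pos_iff_ne_zero.2 fun h0 => hν0 ?_
    refine ae_eq_bot.1 (Filter.eventually_false_iff_eq_bot.1 ?_)
    have hz : ∀ᵐ l ∂ν, l ∉ Function.support fun l => g l - f l := measure_eq_zero_iff_ae_notMem.1 h0
    filter_upwards [hae, hz] with l h1 h2
    exact h2 h1.ne'
  rw [integral_sub hg hf] at hpos
  linarith

lemma energy_midpoint_lt [IsFiniteMeasure ν] (hν : ∀ᵐ l ∂ν, l ∈ Set.Ioo (0 : ℝ) 1)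
    (hν0 : ν ≠ 0) (hB : ∀ j, (B j).PosDef) (hw : ∀ j, 0 < w j) [Nonempty (Fin m)]
    (hX : X.PosSemidef) (hY : Y.PosSemidef) (hne : X ≠ Y) :
    energy ν B w ((2⁻¹ : ℝ) • (X + Y)) < (energy ν B w X + energy ν B w Y) / 2 := by
  unfold energy
  rw [← Finset.sum_add_distrib, Finset.sum_div]
  refine Finset.sum_lt_sum_of_nonempty Finset.univ_nonempty fun j _ => ?_
  have hiX := integrable_kern hν (hB j) hX
  have hiY := integrable_kern hν (hB j) hY
  have := integral_lt_integral_of_forall_Ioo hν hν0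
    (integrable_kern hν (hB j) (midpoint_posSemidef hX hY)) ((hiX.add hiY).div_const 2)
    fun l hl => kern_midpoint_lt hl (hB j) hX hY hne
  have h2 : ∫ l, (kern l (B j) X + kern l (B j) Y) / 2 ∂ν =
      (∫ l, kern l (B j) X ∂ν + ∫ l, kern l (B j) Y ∂ν) / 2 := by
    rw [integral_div, integral_add hiX hiY]
  have h3 := mul_lt_mul_of_pos_left (this.trans_eq h2) (hw j)
  linarith

lemma exists_energy_lt_of_not_posDef [IsFiniteMeasure ν]
    (hν : ∀ᵐ l ∂ν, l ∈ Set.Ioo (0 : ℝ) 1) (hν0 : ν ≠ 0) (hB : ∀ j, (B j).PosDef)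
    (hw : ∀ j, 0 < w j) [Nonempty (Fin m)] (hX : X.PosSemidef) (hXd : ¬ X.PosDef) :
    ∃ Y : Matrix (Fin n) (Fin n) ℂ, Y.PosSemidef ∧ energy ν B w Y < energy ν B w X := by
  obtain ⟨v, hv, hXv⟩ := exists_unit_ker_of_not_posDef hX hXd
  set C : Fin m → ℝ := fun j => (star v ⬝ᵥ (B j)⁻¹ *ᵥ v).re
  have hC : ∀ j, 0 ≤ C j := fun j =>
    (Complex.le_def.1 ((hB j).inv.posSemidef.dotProduct_mulVec_nonneg v)).1
  have hs : 0 < 1 + ∑ j, C j := add_pos_of_pos_of_nonneg one_pos (Finset.sum_nonneg fun j _ => hC j)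
  have ht : 0 < (1 + ∑ j, C j)⁻¹ := inv_pos.2 hs
  have htC : ∀ j, (1 + ∑ j, C j)⁻¹ * C j < 1 := fun j => by
    rw [inv_mul_lt_iff₀ hs]
    have := Finset.single_le_sum (fun j _ => hC j) (Finset.mem_univ j)
    linarith
  have hY : (X + (1 + ∑ j, C j)⁻¹ • vecMulVec v (star v)).PosSemidef :=
    hX.add (posSemidef_smul ht.le (posSemidef_vecMulVec_self_star v))
  refine ⟨_, hY, Finset.sum_lt_sum_of_nonempty Finset.univ_nonempty fun j _ =>
    mul_lt_mul_of_pos_left ?_ (hw j)⟩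
  exact integral_lt_integral_of_forall_Ioo hν hν0 (integrable_kern hν (hB j) hY)
    (integrable_kern hν (hB j) hX)
    fun l hl => kern_add_vecMulVec_lt hl (hB j) hX hXv hv ht (htC j)

lemma integrable_mul_one_sub [IsFiniteMeasure ν] (hν : ∀ᵐ l ∂ν, l ∈ Set.Ioo (0 : ℝ) 1) :
    Integrable (fun l : ℝ => l * (1 - l)) ν := by
  refine Integrable.of_bound (C := 1)
    (by fun_prop : Measurable fun l : ℝ => l * (1 - l)).aestronglyMeasurable ?_
  filter_upwards [hν] with l hl
  rw [Real.norm_of_nonneg (mul_nonneg hl.1.le (sub_nonneg.2 hl.2.le))]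
  nlinarith [hl.1, hl.2]

lemma linear_le_energy [IsFiniteMeasure ν] (hν : ∀ᵐ l ∂ν, l ∈ Set.Ioo (0 : ℝ) 1)
    (hB : ∀ j, (B j).PosDef) (hw : ∀ j, 0 < w j) (hw1 : ∑ j, w j = 1) (hX : X.PosSemidef) :
    (∫ l, l * (1 - l) ∂ν) * (X.trace.re - 3 * ∑ j, w j * (B j).trace.re) ≤ energy ν B w X := by
  calc (∫ l, l * (1 - l) ∂ν) * (X.trace.re - 3 * ∑ j, w j * (B j).trace.re)
      = (∫ l, l * (1 - l) ∂ν) * ((∑ j, w j) * X.trace.re - 3 * ∑ j, w j * (B j).trace.re) := by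
        rw [hw1, one_mul]
    _ = ∑ j, w j * ∫ l, l * (1 - l) * (X.trace.re - 3 * (B j).trace.re) ∂ν := by
        simp only [integral_mul_const, Finset.sum_mul, Finset.mul_sum, ← Finset.sum_sub_distrib]
        exact Finset.sum_congr rfl fun j _ => by ring
    _ ≤ energy ν B w X := by
        refine Finset.sum_le_sum fun j _ => mul_le_mul_of_nonneg_left ?_ (hw j).le
        exact integral_mono_ae ((integrable_mul_one_sub hν).mul_const _) (integrable_kern hν (hB j) hX)
          (hν.mono fun l hl => linear_le_kern hl (hB j) hX)

lemma exists_isMinOn_energy [IsFiniteMeasure ν] (hν : ∀ᵐ l ∂ν, l ∈ Set.Ioo (0 : ℝ) 1)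
    (hν0 : ν ≠ 0) (hB : ∀ j, (B j).PosDef) (hw : ∀ j, 0 < w j) (hw1 : ∑ j, w j = 1) :
    ∃ X : Matrix (Fin n) (Fin n) ℂ, X.PosSemidef ∧
      ∀ Y : Matrix (Fin n) (Fin n) ℂ, Y.PosSemidef → energy ν B w X ≤ energy ν B w Y := by
  have hκ : 0 < ∫ l, l * (1 - l) ∂ν := by
    have := integral_lt_integral_of_forall_Ioo hν hν0 (integrable_zero ℝ ℝ ν)
      (integrable_mul_one_sub hν) fun l hl => mul_pos hl.1 (sub_pos.2 hl.2)
    simpa using this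
  set κ := ∫ l, l * (1 - l) ∂ν
  set R := max 0 (energy ν B w 0 / κ + 3 * ∑ j, w j * (B j).trace.re)
  have h0 : (0 : Matrix (Fin n) (Fin n) ℂ) ∈ {X : Matrix (Fin n) (Fin n) ℂ |
      X.PosSemidef ∧ X.trace.re ≤ R} := ⟨PosSemidef.zero, by simp [R]⟩
  obtain ⟨X, hXK, hX⟩ := (isCompact_posSemidef_trace_le (n := n) R).exists_isMinOn ⟨0, h0⟩
    (continuousOn_energy (w := w) hν hB R)
  refine ⟨X, hXK.1, fun Y hY => ?_⟩
  by_cases hR : Y.trace.re ≤ R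
  · exact hX ⟨hY, hR⟩
  · refine (hX h0).trans (le_trans ?_ (linear_le_energy hν hB hw hw1 hY))
    have h1 : energy ν B w 0 / κ ≤ Y.trace.re - 3 * ∑ j, w j * (B j).trace.re := by
      linarith [le_max_right 0 (energy ν B w 0 / κ + 3 * ∑ j, w j * (B j).trace.re), not_le.1 hR]
    exact (div_le_iff₀' hκ).1 h1

end Energy

end QHD

/-- If the support of `μ` is not contained in `{0,1}`, then for positive
definite `A₁, …, A_m` and positive weights summing to `1`, the function
`X ↦ Σ_j w_j φ_μ(A_j, X)` attains a unique minimizer on the positive definite cone. -/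
theorem qhd_barycenter_exists_unique {n m : ℕ} (μ : Measure ℝ) [IsProbabilityMeasure μ]
    (hμ01 : μ (Set.Icc (0 : ℝ) 1) = 1) (hsupp : μ ({0, 1} : Set ℝ)ᶜ ≠ 0)
    (A : Fin m → Matrix (Fin n) (Fin n) ℂ) (hA : ∀ j, (A j).PosDef)
    (w : Fin m → ℝ) (hw : ∀ j, 0 < w j) (hw1 : ∑ j, w j = 1) :
    ∃! X₀ : Matrix (Fin n) (Fin n) ℂ, X₀.PosDef ∧
      ∀ X : Matrix (Fin n) (Fin n) ℂ, X.PosDef →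
        ∑ j, w j * qhd μ (A j) X₀ ≤ ∑ j, w j * qhd μ (A j) X := by
  set ν := μ.restrict (Set.Ioo (0 : ℝ) 1) with hνdef
  have hν : ∀ᵐ l ∂ν, l ∈ Set.Ioo (0 : ℝ) 1 := ae_restrict_mem measurableSet_Ioo
  have hν0 : ν ≠ 0 := by
    intro h
    rw [hνdef, Measure.restrict_eq_zero] at h
    refine hsupp (measure_mono_null (t := Set.Ioo (0 : ℝ) 1 ∪ (Set.Icc (0 : ℝ) 1)ᶜ) ?_
      (measure_union_null h ((prob_compl_eq_zero_iff measurableSet_Icc).2 hμ01)))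
    intro l hl
    by_cases hI : l ∈ Set.Icc (0 : ℝ) 1
    · simp only [Set.mem_compl_iff, Set.mem_insert_iff, Set.mem_singleton_iff, not_or] at hl
      exact Or.inl ⟨lt_of_le_of_ne hI.1 (Ne.symm hl.1), lt_of_le_of_ne hI.2 hl.2⟩
    · exact Or.inr hI
  have hm : Nonempty (Fin m) := by
    by_contra hm
    rw [not_nonempty_iff] at hm
    simp at hw1
  have heq : ∀ X : Matrix (Fin n) (Fin n) ℂ, X.PosDef →
      ∑ j, w j * qhd μ (A j) X = QHD.energy ν A w X := fun X hX =>
    Finset.sum_congr rfl fun j _ => by rw [QHD.qhd_eq_integral_kern hμ01 (hA j) hX]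
  obtain ⟨X, hX, hmin⟩ := QHD.exists_isMinOn_energy hν hν0 hA hw hw1
  have hXd : X.PosDef := by
    by_contra hXd
    obtain ⟨Y, hY, hlt⟩ := QHD.exists_energy_lt_of_not_posDef hν hν0 hA hw hX hXd
    exact (hmin Y hY).not_gt hlt
  refine ⟨X, ⟨hXd, fun Y hY => ?_⟩, fun Y ⟨hYd, hYmin⟩ => ?_⟩
  · rw [heq X hXd, heq Y hY]
    exact hmin Y hY.posSemidef
  · by_contra hne
    have h1 := QHD.energy_midpoint_lt hν hν0 hA hw hYd.posSemidef hX hne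
    have h2 := hmin _ (QHD.midpoint_posSemidef hYd.posSemidef hX)
    have h3 := hYmin X hXd
    rw [heq X hXd, heq Y hYd] at h3
    linarith
end

section
/- Let μ be a Borel probability measure on [0,1]. For every positive definite n×n complex matrix X and every Hermitian n×n matrix Y, the Fréchet derivative of the map X ↦ f_μ(X) (functional calculus) satisfies D f_μ(X)[Y] = ∫_{[0,1]} λ ((1-λ)X + λI)^{-1} Y ((1-λ)X + λI)^{-1} dμ(λ). -/
open MeasureTheory Matrix
open scoped ComplexOrder

attribute [local instance] Matrix.frobeniusNormedAddCommGroup Matrix.frobeniusNormedSpace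

section

attribute [local instance] Matrix.frobeniusNormedRing Matrix.frobeniusNormedAlgebra

open scoped Topology

variable {n : ℕ} {A X Y : Matrix (Fin n) (Fin n) ℂ}

lemma Matrix.PosDef.interp_one (hA : A.PosDef) {l : ℝ} (hl : l ∈ Set.Icc (0 : ℝ) 1) :
    ((1 - l) • A + l • (1 : Matrix (Fin n) (Fin n) ℂ)).PosDef := by
  rcases hl.1.eq_or_lt with rfl | h
  · simpa using hA
  · exact PosDef.posSemidef_add (hA.posSemidef.smul (sub_nonneg.2 hl.2)) (PosDef.one.smul h)

lemma Matrix.PosDef.pos_of_mem_spectrum (hA : A.PosDef) {x : ℝ} (hx : x ∈ spectrum ℝ A) :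
    0 < x := by
  rw [hA.isHermitian.spectrum_real_eq_range_eigenvalues] at hx
  obtain ⟨i, rfl⟩ := hx
  exact hA.eigenvalues_pos i

lemma interp_one_pos {l x : ℝ} (hl : l ∈ Set.Icc (0 : ℝ) 1) (hx : 0 < x) :
    0 < (1 - l) * x + l := by
  rcases hl.1.eq_or_lt with rfl | h
  · simpa using hx
  · have := mul_nonneg (sub_nonneg.2 hl.2) hx.le
    linarith

lemma Matrix.PosDef.eventually_add_smul (hX : X.PosDef) (hY : Y.IsHermitian) :
    ∀ᶠ t : ℝ in 𝓝 0, (X + t • Y).PosDef := by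
  have hK : IsCompact (Metric.sphere (0 : Fin n → ℂ) 1) := isCompact_sphere _ _
  have hcont : Continuous fun z : ℝ × (Fin n → ℂ) =>
      (star z.2 ⬝ᵥ ((X + z.1 • Y) *ᵥ z.2)).re := by
    refine Complex.continuous_re.comp ?_
    simp only [dotProduct, mulVec, Pi.star_apply, Matrix.add_apply, Matrix.smul_apply]
    fun_prop
  have key := hK.eventually_forall_of_forall_eventually (x₀ := (0 : ℝ))
    (P := fun t x => 0 < (star x ⬝ᵥ ((X + t • Y) *ᵥ x)).re) (by
      intro y hy
      refine hcont.continuousAt.eventually (lt_mem_nhds ?_)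
      have hy0 : y ≠ 0 := by
        rintro rfl
        simp at hy
      simpa using (Complex.lt_def.1 (hX.dotProduct_mulVec_pos hy0)).1)
  filter_upwards [key] with t ht
  have hherm : (X + t • Y).IsHermitian := hX.isHermitian.add (IsSelfAdjoint.smul (.all t) hY)
  refine .of_dotProduct_mulVec_pos hherm fun x hx => ?_
  have hx' : 0 < ‖x‖ := norm_pos_iff.2 hx
  have h1 := ht ((‖x‖⁻¹ : ℝ) • x) (by simp [norm_smul, hx'.ne'])
  rw [star_smul, mulVec_smul, smul_dotProduct, dotProduct_smul] at h1
  simp only [star_trivial, Complex.smul_re, smul_eq_mul] at h1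
  rw [Complex.lt_def]
  refine ⟨?_, ?_⟩
  · have h2 : 0 < ‖x‖⁻¹ := inv_pos.2 hx'
    exact (mul_pos_iff_of_pos_left h2).1 ((mul_pos_iff_of_pos_left h2).1 h1)
  · exact (hherm.im_star_dotProduct_mulVec_self x).symm

lemma Matrix.PosDef.cfc_div_interp (hA : A.PosDef) {l : ℝ} (hl : l ∈ Set.Icc (0 : ℝ) 1) :
    cfc (fun x : ℝ => x / ((1 - l) * x + l)) A =
      A * ((1 - l) • A + l • (1 : Matrix (Fin n) (Fin n) ℂ))⁻¹ := by
  have hsa : IsSelfAdjoint A := hA.isHermitian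
  have hne : ∀ x ∈ spectrum ℝ A, (1 - l) * x + l ≠ 0 := fun x hx =>
    (interp_one_pos hl (hA.pos_of_mem_spectrum hx)).ne'
  have hc : ContinuousOn (fun x : ℝ => x / ((1 - l) * x + l)) (spectrum ℝ A) :=
    ContinuousOn.div (by fun_prop) (by fun_prop) hne
  have haff : cfc (fun x : ℝ => (1 - l) * x + l) A = (1 - l) • A + l • 1 := by
    rw [cfc_add_const l (fun x => (1 - l) * x) A, cfc_const_mul_id (1 - l) A,
      Algebra.algebraMap_eq_smul_one]
  have hmul : cfc (fun x : ℝ => x / ((1 - l) * x + l)) A * ((1 - l) • A + l • 1) = A := by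
    rw [← haff, ← cfc_mul _ _ A hc (by fun_prop)]
    conv_rhs => rw [← cfc_id' ℝ A]
    exact cfc_congr fun x hx => div_mul_cancel₀ _ (hne x hx)
  have hu := (hA.interp_one hl).isUnit
  rw [← mul_nonsing_inv_cancel_right _ (cfc _ A) ((isUnit_iff_isUnit_det _).1 hu), hmul]

lemma Matrix.PosDef.cfc_fmu (hA : A.PosDef) (μ : Measure ℝ) [IsFiniteMeasure μ]
    (hμ : μ.restrict (Set.Icc 0 1) = μ) :
    cfc (fmu μ) A = ∫ l, A * ((1 - l) • A + l • (1 : Matrix (Fin n) (Fin n) ℂ))⁻¹ ∂μ := by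
  have hsa : IsSelfAdjoint A := hA.isHermitian
  have hcont : ContinuousOn (Function.uncurry fun l x : ℝ => x / ((1 - l) * x + l))
      (Set.Icc 0 1 ×ˢ spectrum ℝ A) :=
    ContinuousOn.div (by fun_prop) (by fun_prop) fun z hz =>
      (interp_one_pos hz.1 (hA.pos_of_mem_spectrum hz.2)).ne'
  have hfin : (spectrum ℝ A).Finite := by
    rw [hA.isHermitian.spectrum_real_eq_range_eigenvalues]
    exact Set.finite_range _
  obtain ⟨C, hC⟩ := (isCompact_Icc.prod hfin.isCompact).exists_bound_of_continuousOn hcont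
  have h := @cfc_setIntegral ℝ ℝ (Matrix (Fin n) (Fin n) ℂ) IsSelfAdjoint _ _ μ _ _ _
    IsHermitian.instContinuousFunctionalCalculus _ _ _ _ _ measurableSet_Icc
    (fun l x : ℝ => x / ((1 - l) * x + l)) (fun _ => C) A _ hcont
    (ae_restrict_of_forall_mem measurableSet_Icc fun l hl x hx => hC (l, x) ⟨hl, hx⟩)
    (integrable_const C).2 hsa
  rw [hμ] at h
  refine h.trans (integral_congr_ae ?_)
  rw [← hμ]
  exact ae_restrict_of_forall_mem measurableSet_Icc fun l hl => hA.cfc_div_interp hl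

lemma hasDerivAt_mul_interp_inv {l t : ℝ}
    (hu : IsUnit ((1 - l) • (X + t • Y) + l • (1 : Matrix (Fin n) (Fin n) ℂ))) :
    HasDerivAt (fun t : ℝ => (X + t • Y) *
        ((1 - l) • (X + t • Y) + l • (1 : Matrix (Fin n) (Fin n) ℂ))⁻¹)
      (l • (((1 - l) • (X + t • Y) + l • (1 : Matrix (Fin n) (Fin n) ℂ))⁻¹ * Y *
        ((1 - l) • (X + t • Y) + l • (1 : Matrix (Fin n) (Fin n) ℂ))⁻¹)) t := by
  have hlin : HasDerivAt (fun t : ℝ => X + t • Y) Y t := by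
    have h := ((hasDerivAt_id t).smul_const Y).const_add X
    rw [one_smul] at h
    exact h
  have haff : HasDerivAt (fun t : ℝ => (1 - l) • (X + t • Y) +
      l • (1 : Matrix (Fin n) (Fin n) ℂ)) ((1 - l) • Y) t :=
    (hlin.const_smul (1 - l)).add_const _
  obtain ⟨u, hu'⟩ := hu
  have hinv := hasFDerivAt_ringInverse (𝕜 := ℝ) u
  rw [hu'] at hinv
  have h := hlin.mul (hinv.comp_hasDerivAt t haff)
  have hR : (↑u⁻¹ : Matrix (Fin n) (Fin n) ℂ) =
      ((1 - l) • (X + t • Y) + l • (1 : Matrix (Fin n) (Fin n) ℂ))⁻¹ := by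
    rw [← hu', coe_units_inv]
  simp only [Function.comp_def, ← nonsing_inv_eq_ringInverse] at h
  refine h.congr_deriv ?_
  rw [← hR]
  generalize X + t • Y = A at hu' ⊢
  have hmul : l • (↑u⁻¹ : Matrix (Fin n) (Fin n) ℂ) = 1 - (1 - l) • (A * (↑u⁻¹ : Matrix (Fin n) (Fin n) ℂ)) := by
    rw [← u.mul_inv, hu', add_mul, smul_mul_assoc, smul_mul_assoc, one_mul, add_sub_cancel_left]
  rw [← smul_mul_assoc, ← smul_mul_assoc, hmul, _root_.sub_mul, _root_.sub_mul, one_mul]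
  simp [mul_assoc, sub_eq_add_neg]

lemma continuousOn_interp_inv {s : Set ℝ} (hs : ∀ t ∈ s, (X + t • Y).PosDef) :
    ContinuousOn (fun z : ℝ × ℝ =>
        ((1 - z.2) • (X + z.1 • Y) + z.2 • (1 : Matrix (Fin n) (Fin n) ℂ))⁻¹)
      (s ×ˢ Set.Icc 0 1) := by
  intro z hz
  obtain ⟨u, hu⟩ := ((hs z.1 hz.1).interp_one hz.2).isUnit
  have h := NormedRing.inverse_continuousAt u
  rw [hu] at h
  simp only [nonsing_inv_eq_ringInverse]
  refine ContinuousAt.continuousWithinAt (ContinuousAt.comp (f := fun z : ℝ × ℝ =>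
    (1 - z.2) • (X + z.1 • Y) + z.2 • (1 : Matrix (Fin n) (Fin n) ℂ)) h ?_)
  fun_prop

end

lemma hasDerivAt_integral_of_continuousOn_prod {E : Type*} [NormedAddCommGroup E] [NormedSpace ℝ E]
    {μ : Measure ℝ} [IsFiniteMeasure μ] {K : Set ℝ} (hK : IsCompact K) (hμ : μ.restrict K = μ)
    {t₀ ε : ℝ} (hε : 0 < ε) {F F' : ℝ → ℝ → E}
    (hF : ContinuousOn (Function.uncurry F) (Metric.closedBall t₀ ε ×ˢ K))
    (hF' : ContinuousOn (Function.uncurry F') (Metric.closedBall t₀ ε ×ˢ K))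
    (hderiv : ∀ l ∈ K, ∀ t ∈ Metric.closedBall t₀ ε, HasDerivAt (F · l) (F' t l) t) :
    HasDerivAt (fun t => ∫ l, F t l ∂μ) (∫ l, F' t₀ l ∂μ) t₀ := by
  have hmem : ∀ᵐ l ∂μ, l ∈ K := hμ ▸ ae_restrict_mem hK.measurableSet
  obtain ⟨C, hC⟩ := ((isCompact_closedBall _ _).prod hK).exists_bound_of_continuousOn hF'
  have hint : ∀ {G : ℝ → ℝ → E},
      ContinuousOn (Function.uncurry G) (Metric.closedBall t₀ ε ×ˢ K) →
      ∀ t ∈ Metric.closedBall t₀ ε, Integrable (G t) μ := fun {G} hG t ht => by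
    have h : ContinuousOn (G t) K :=
      hG.comp (Continuous.prodMk_right t).continuousOn fun l hl => ⟨ht, hl⟩
    have := h.integrableOn_compact (μ := μ) hK
    rwa [IntegrableOn, hμ] at this
  have h₀ : t₀ ∈ Metric.closedBall t₀ ε := Metric.mem_closedBall_self hε.le
  have hball : Metric.closedBall t₀ ε ∈ nhds t₀ := Metric.closedBall_mem_nhds _ hε
  exact (hasDerivAt_integral_of_dominated_loc_of_deriv_le (bound := fun _ => C) hball
    (Filter.eventually_of_mem hball fun t ht => (hint hF t ht).1) (hint hF t₀ h₀)
    (hint hF' t₀ h₀).1 (hmem.mono fun l hl t ht => hC (t, l) ⟨ht, hl⟩) (integrable_const C)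
    (hmem.mono hderiv)).2

/-- The Fréchet derivative of the functional calculus map `X ↦ f_μ(X)` at a
positive definite `X` in a Hermitian direction `Y` is
`∫ λ ((1-λ)X + λI)⁻¹ Y ((1-λ)X + λI)⁻¹ dμ(λ)`. -/
theorem fmu_matrix_deriv {n : ℕ} (μ : Measure ℝ) [IsProbabilityMeasure μ]
    (hμ01 : μ (Set.Icc (0 : ℝ) 1) = 1)
    (X Y : Matrix (Fin n) (Fin n) ℂ) (hX : X.PosDef) (hY : Y.IsHermitian) :
    HasDerivAt (fun t : ℝ => cfc (fmu μ) (X + t • Y))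
      (∫ l, l • (((1 - l) • X + l • (1 : Matrix (Fin n) (Fin n) ℂ))⁻¹ * Y *
        ((1 - l) • X + l • (1 : Matrix (Fin n) (Fin n) ℂ))⁻¹) ∂μ) 0 := by
  have hμ : μ.restrict (Set.Icc 0 1) = μ :=
    Measure.restrict_eq_self_of_ae_mem ((prob_compl_eq_zero_iff measurableSet_Icc).2 hμ01)
  obtain ⟨ε, hε, hpos⟩ := Metric.nhds_basis_closedBall.eventually_iff.1 (hX.eventually_add_smul hY)
  have hinv := continuousOn_interp_inv (s := Metric.closedBall 0 ε) fun t ht => hpos ht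
  have hF : ContinuousOn (fun z : ℝ × ℝ => (X + z.1 • Y) *
      ((1 - z.2) • (X + z.1 • Y) + z.2 • (1 : Matrix (Fin n) (Fin n) ℂ))⁻¹)
      (Metric.closedBall 0 ε ×ˢ Set.Icc 0 1) :=
    ContinuousOn.mul (f := fun z : ℝ × ℝ => X + z.1 • Y) (by fun_prop) hinv
  have hF' : ContinuousOn (fun z : ℝ × ℝ => z.2 •
      (((1 - z.2) • (X + z.1 • Y) + z.2 • (1 : Matrix (Fin n) (Fin n) ℂ))⁻¹ * Y *
        ((1 - z.2) • (X + z.1 • Y) + z.2 • (1 : Matrix (Fin n) (Fin n) ℂ))⁻¹))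
      (Metric.closedBall 0 ε ×ˢ Set.Icc 0 1) :=
    continuousOn_snd.smul ((hinv.mul continuousOn_const).mul hinv)
  have h := hasDerivAt_integral_of_continuousOn_prod isCompact_Icc hμ hε
    (F := fun t l => (X + t • Y) *
      ((1 - l) • (X + t • Y) + l • (1 : Matrix (Fin n) (Fin n) ℂ))⁻¹)
    (F' := fun t l => l • (((1 - l) • (X + t • Y) +
      l • (1 : Matrix (Fin n) (Fin n) ℂ))⁻¹ * Y *
        ((1 - l) • (X + t • Y) + l • (1 : Matrix (Fin n) (Fin n) ℂ))⁻¹)) hF hF'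
    fun l hl t ht => hasDerivAt_mul_interp_inv ((hpos ht).interp_one hl).isUnit
  simp only [zero_smul, add_zero] at h
  refine HasDerivAt.congr_of_eventuallyEq h ?_
  filter_upwards [Metric.closedBall_mem_nhds (0 : ℝ) hε] with t ht
  exact (hpos ht).cfc_fmu μ hμ
end

section
/- Let f : (0,∞) → ℝ be a strictly concave C¹ function, let A₁, …, A_m be pairwise commuting positive definite n×n complex matrices, and let w₁, …, w_m be positive reals with Σ_j w_j = 1. Then a positive definite matrix X commuting with all A_j is a critical point of X ↦ Σ_{j=1}^m w_j φ_f(A_j, X) (restricted to the commutative algebra generated by the A_j's and X) if and only if X = (1/f'(1)) Σ_{j=1}^m w_j X f'(A_j^{-1}X), where f' is applied via the functional calculus. -/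
open MeasureTheory Matrix
open scoped ComplexOrder

/-- The generalized quantum Hellinger divergence in the commutative setting:
`φ_f(A,B) = Tr((f(1)-f'(1))A + f'(1)B - A f(A⁻¹B))`, with `f` applied via the functional
calculus. -/
noncomputable def phiF {n : ℕ} (f : ℝ → ℝ) (A B : Matrix (Fin n) (Fin n) ℂ) : ℝ :=
  (((f 1 - deriv f 1) • A + deriv f 1 • B - A * cfc f (A⁻¹ * B)).trace).re

namespace Matrix

variable {n : Type*} [Fintype n] [DecidableEq n]

/-- A pairwise commuting family of Hermitian matrices has a common orthonormal eigenbasis. -/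
theorem exists_orthonormalBasis_forall_mulVec_eq {κ : Type*} {M : κ → Matrix n n ℂ}
    (hM : ∀ k, (M k).IsHermitian) (hcomm : ∀ k l, Commute (M k) (M l)) :
    ∃ (b : OrthonormalBasis n ℂ (EuclideanSpace ℂ n)) (d : κ → n → ℝ),
      ∀ k i, toEuclideanLin (M k) (b i) = (d k i : ℂ) • b i := by
  classical
  let T : κ → Module.End ℂ (EuclideanSpace ℂ n) := fun k => toEuclideanLin (M k)
  have hT : ∀ k, (T k).IsSymmetric := fun k => isSymmetric_toEuclideanLin_iff.mpr (hM k)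
  have hTcomm : Pairwise (Function.onFun Commute T) := by
    intro k l _
    exact (hcomm k l).map (Matrix.toLpLinAlgEquiv (R := ℂ) (n := n) 2)
  let V : (κ → ℂ) → Submodule ℂ (EuclideanSpace ℂ n) :=
    fun χ => ⨅ k, Module.End.eigenspace (T k) (χ k)
  have hV : DirectSum.IsInternal V :=
    LinearMap.IsSymmetric.directSum_isInternal_of_pairwise_commute hT hTcomm
  have hfin : {χ | V χ ≠ ⊥}.Finite :=
    WellFoundedGT.finite_ne_bot_of_iSupIndep hV.submodule_iSupIndep
  have : Fintype {χ // V χ ≠ ⊥} := hfin.fintype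
  have hV₀ : DirectSum.IsInternal fun χ : {χ // V χ ≠ ⊥} => V χ :=
    DirectSum.isInternal_ne_bot_iff.mpr hV
  have horth : OrthogonalFamily ℂ (fun χ : {χ // V χ ≠ ⊥} => V χ) fun χ => (V χ).subtypeₗᵢ :=
    (LinearMap.IsSymmetric.orthogonalFamily_iInf_eigenspaces hT).comp Subtype.coe_injective
  have hdim := finrank_euclideanSpace (𝕜 := ℂ) (ι := n)
  let e : Fin (Fintype.card n) ≃ n := Fintype.equivOfCardEq (Fintype.card_fin _)
  let b := (hV₀.subordinateOrthonormalBasis hdim horth).reindex e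
  let χ : n → κ → ℂ := fun i => (hV₀.subordinateOrthonormalBasisIndex hdim (e.symm i) horth).val
  have hb : ∀ k i, T k (b i) = χ i k • b i := by
    intro k i
    have h := hV₀.subordinateOrthonormalBasis_subordinate hdim (e.symm i) horth
    have h' := (Submodule.mem_iInf _).mp h k
    rw [Module.End.mem_eigenspace_iff] at h'
    simpa [b, χ] using h'
  refine ⟨b, fun k i => (χ i k).re, fun k i => ?_⟩
  have hreal : (starRingEnd ℂ) (χ i k) = χ i k :=
    (hT k).conj_eigenvalue_eq_self <| Module.End.hasEigenvalue_of_hasEigenvector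
      ⟨Module.End.mem_eigenspace_iff.mpr (hb k i), b.orthonormal.ne_zero i⟩
  rw [Complex.conj_eq_iff_re.mp hreal]
  exact hb k i

/-- The algebra homomorphism sending a real vector `d` to `U * diagonal d * U⁻¹`. -/
noncomputable def conjDiagonal (U : unitaryGroup n ℂ) : (n → ℝ) →ₐ[ℝ] Matrix n n ℂ :=
  ((Unitary.conjStarAlgAut ℝ (Matrix n n ℂ) U : Matrix n n ℂ ≃⋆ₐ[ℝ] Matrix n n ℂ) :
      Matrix n n ℂ →ₐ[ℝ] Matrix n n ℂ).comp <|
    (diagonalAlgHom ℝ).comp <| Complex.ofRealAm.compLeft n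

theorem conjDiagonal_apply (U : unitaryGroup n ℂ) (d : n → ℝ) :
    conjDiagonal U d = U * diagonal (fun i => (d i : ℂ)) * star (U : Matrix n n ℂ) :=
  rfl

theorem conjDiagonal_injective (U : unitaryGroup n ℂ) : Function.Injective (conjDiagonal U) := by
  intro d e h
  have h' : diagonal (fun i => (d i : ℂ)) = diagonal fun i => (e i : ℂ) :=
    (Unitary.conjStarAlgAut ℝ (Matrix n n ℂ) U).injective h
  funext i
  exact_mod_cast congrFun (diagonal_injective h') i

theorem trace_conjDiagonal (U : unitaryGroup n ℂ) (d : n → ℝ) :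
    (conjDiagonal U d).trace = ∑ i, (d i : ℂ) := by
  rw [conjDiagonal_apply, trace_mul_cycle, Unitary.coe_star_mul_self, one_mul, trace_diagonal]

theorem isHermitian_conjDiagonal (U : unitaryGroup n ℂ) (d : n → ℝ) :
    (conjDiagonal U d).IsHermitian := by
  rw [conjDiagonal_apply]
  exact isHermitian_mul_mul_conjTranspose _
    (isHermitian_diagonal_of_self_adjoint _ (by ext i; simp))

theorem commute_conjDiagonal (U : unitaryGroup n ℂ) (d e : n → ℝ) :
    Commute (conjDiagonal U d) (conjDiagonal U e) :=
  (Commute.all d e).map (conjDiagonal U)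

theorem inv_conjDiagonal (U : unitaryGroup n ℂ) {d : n → ℝ} (hd : ∀ i, d i ≠ 0) :
    (conjDiagonal U d)⁻¹ = conjDiagonal U d⁻¹ := by
  apply inv_eq_right_inv
  rw [← map_mul, ← map_one (conjDiagonal U)]
  congr 1
  funext i
  exact mul_inv_cancel₀ (hd i)

theorem posDef_conjDiagonal_iff (U : unitaryGroup n ℂ) (d : n → ℝ) :
    (conjDiagonal U d).PosDef ↔ ∀ i, 0 < d i := by
  rw [conjDiagonal_apply,
    IsUnit.posDef_star_right_conjugate_iff (U := U.val) (Unitary.toUnits U).isUnit]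
  simp [posDef_diagonal_iff]

theorem cfc_conjDiagonal (U : unitaryGroup n ℂ) (f : ℝ → ℝ) (d : n → ℝ) :
    cfc f (conjDiagonal U d) = conjDiagonal U (f ∘ d) := by
  classical
  let s : Finset ℝ := Finset.univ.image d
  let p : Polynomial ℝ := Lagrange.interpolate s id f
  have hp : ∀ i, p.eval (d i) = f (d i) := fun i =>
    Lagrange.eval_interpolate_at_node f Function.injective_id.injOn
      (Finset.mem_image_of_mem d (Finset.mem_univ i))
  have hspec : (spectrum ℝ (conjDiagonal U d)).EqOn f p.eval := by
    intro x hx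
    have hx' := AlgHom.spectrum_apply_subset (conjDiagonal U) d hx
    rw [Pi.spectrum_eq] at hx'
    obtain ⟨i, hi⟩ := Set.mem_iUnion.mp hx'
    obtain rfl : x = d i := by
      simpa [spectrum.mem_iff, isUnit_iff_ne_zero, sub_eq_zero] using hi
    exact (hp i).symm
  rw [cfc_congr hspec, cfc_polynomial p _ (isHermitian_conjDiagonal U d).isSelfAdjoint,
    Polynomial.aeval_algHom_apply]
  congr 1
  funext i
  simp [hp]

/-- A pairwise commuting family of Hermitian matrices is simultaneously diagonalizable by a
unitary matrix. -/
theorem exists_forall_eq_conjDiagonal {κ : Type*} {M : κ → Matrix n n ℂ}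
    (hM : ∀ k, (M k).IsHermitian) (hcomm : ∀ k l, Commute (M k) (M l)) :
    ∃ (U : unitaryGroup n ℂ) (d : κ → n → ℝ), ∀ k, M k = conjDiagonal U (d k) := by
  obtain ⟨b, d, hb⟩ := exists_orthonormalBasis_forall_mulVec_eq hM hcomm
  let U : unitaryGroup n ℂ :=
    ⟨(EuclideanSpace.basisFun n ℂ).toBasis.toMatrix b.toBasis,
      (EuclideanSpace.basisFun n ℂ).toMatrix_orthonormalBasis_mem_unitary b⟩
  refine ⟨U, d, fun k => ?_⟩
  have hU : M k * U = U * diagonal fun i => (d k i : ℂ) := by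
    ext r i
    have h := congrArg (fun v : EuclideanSpace ℂ n => v r) (hb k i)
    simp only [PiLp.smul_apply, smul_eq_mul] at h
    rw [mul_diagonal, mul_comm]
    exact h
  rw [conjDiagonal_apply, ← hU, mul_assoc, Unitary.mul_star_self_of_mem U.2, mul_one]

end Matrix

section HellingerDivergence

variable {n : ℕ} {f : ℝ → ℝ} (U : unitaryGroup (Fin n) ℂ)

theorem phiF_conjDiagonal {a : Fin n → ℝ} (ha : ∀ i, a i ≠ 0) (b : Fin n → ℝ) :
    phiF f (conjDiagonal U a) (conjDiagonal U b) =
      ∑ i, ((f 1 - deriv f 1) * a i + deriv f 1 * b i - a i * f ((a i)⁻¹ * b i)) := by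
  rw [phiF, inv_conjDiagonal U ha, ← map_mul, cfc_conjDiagonal, ← map_mul, ← map_smul, ← map_smul,
    ← map_add, ← map_sub, trace_conjDiagonal, ← Complex.ofReal_sum, Complex.ofReal_re]
  rfl

theorem hasDerivAt_phiF_conjDiagonal (hf : DifferentiableOn ℝ f (Set.Ioi 0)) {a x : Fin n → ℝ}
    (ha : ∀ i, 0 < a i) (hx : ∀ i, 0 < x i) (y : Fin n → ℝ) :
    HasDerivAt (fun t : ℝ => phiF f (conjDiagonal U a) (conjDiagonal U x + t • conjDiagonal U y))
      (∑ i, y i * (deriv f 1 - deriv f ((a i)⁻¹ * x i))) 0 := by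
  have h : ∀ t : ℝ, phiF f (conjDiagonal U a) (conjDiagonal U x + t • conjDiagonal U y) =
      ∑ i, ((f 1 - deriv f 1) * a i + deriv f 1 * (x i + t * y i) -
        a i * f ((a i)⁻¹ * (x i + t * y i))) := fun t => by
    rw [← map_smul, ← map_add, phiF_conjDiagonal U fun i => (ha i).ne']
    rfl
  simp_rw [h]
  refine HasDerivAt.fun_sum fun i _ => ?_
  have hline : HasDerivAt (fun t : ℝ => x i + t * y i) (y i) 0 := by
    simpa using ((hasDerivAt_id (0 : ℝ)).mul_const (y i)).const_add (x i)
  have hpos : 0 < (a i)⁻¹ * x i := mul_pos (inv_pos.mpr (ha i)) (hx i)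
  have hfi : HasDerivAt f (deriv f ((a i)⁻¹ * x i)) ((a i)⁻¹ * (x i + 0 * y i)) := by
    simpa using (hf.differentiableAt (Ioi_mem_nhds hpos)).hasDerivAt
  have hcomp := hfi.comp (0 : ℝ) (hline.const_mul (a i)⁻¹)
  refine (((hline.const_mul (deriv f 1)).const_add ((f 1 - deriv f 1) * a i)).sub
    (hcomp.const_mul (a i))).congr_deriv ?_
  have := (ha i).ne'
  field_simp

theorem hasDerivAt_sum_phiF_conjDiagonal {ι : Type*} [Fintype ι]
    (hf : DifferentiableOn ℝ f (Set.Ioi 0)) {a : ι → Fin n → ℝ} {x : Fin n → ℝ}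
    (ha : ∀ j i, 0 < a j i) (hx : ∀ i, 0 < x i) (y : Fin n → ℝ)
    {w : ι → ℝ} (hw : ∑ j, w j = 1) :
    HasDerivAt (fun t : ℝ => ∑ j, w j *
        phiF f (conjDiagonal U (a j)) (conjDiagonal U x + t • conjDiagonal U y))
      (∑ i, y i * (deriv f 1 - ∑ j, w j * deriv f ((a j i)⁻¹ * x i))) 0 := by
  refine (HasDerivAt.fun_sum fun j _ =>
    (hasDerivAt_phiF_conjDiagonal U hf (ha j) hx y).const_mul (w j)).congr_deriv ?_
  simp_rw [Finset.mul_sum]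
  rw [Finset.sum_comm]
  refine Finset.sum_congr rfl fun i _ => ?_
  calc ∑ j, w j * (y i * (deriv f 1 - deriv f ((a j i)⁻¹ * x i)))
      = y i * ((∑ j, w j) * deriv f 1 - ∑ j, w j * deriv f ((a j i)⁻¹ * x i)) := by
        rw [Finset.sum_mul, ← Finset.sum_sub_distrib, Finset.mul_sum]
        exact Finset.sum_congr rfl fun j _ => by ring
    _ = _ := by rw [hw, one_mul]

theorem conjDiagonal_eq_smul_sum_iff {ι : Type*} [Fintype ι] (hf1 : deriv f 1 ≠ 0)
    {a : ι → Fin n → ℝ} {x : Fin n → ℝ} (ha : ∀ j i, a j i ≠ 0) (hx : ∀ i, x i ≠ 0) (w : ι → ℝ) :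
    conjDiagonal U x = (1 / deriv f 1) • ∑ j, w j •
        (conjDiagonal U x * cfc (deriv f) ((conjDiagonal U (a j))⁻¹ * conjDiagonal U x)) ↔
      ∀ i, ∑ j, w j * deriv f ((a j i)⁻¹ * x i) = deriv f 1 := by
  have h : (1 / deriv f 1) • ∑ j, w j •
        (conjDiagonal U x * cfc (deriv f) ((conjDiagonal U (a j))⁻¹ * conjDiagonal U x)) =
      conjDiagonal U ((1 / deriv f 1) • ∑ j, w j • (x * (deriv f ∘ ((a j)⁻¹ * x)))) := by
    simp_rw [map_smul, map_sum, map_smul, map_mul]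
    refine congrArg _ (Finset.sum_congr rfl fun j _ => ?_)
    rw [inv_conjDiagonal U (ha j), ← map_mul, cfc_conjDiagonal]
  rw [h, (conjDiagonal_injective U).eq_iff, funext_iff]
  refine forall_congr' fun i => ?_
  have hsum : ((1 / deriv f 1) • ∑ j, w j • (x * (deriv f ∘ ((a j)⁻¹ * x)))) i =
      1 / deriv f 1 * (x i * ∑ j, w j * deriv f ((a j i)⁻¹ * x i)) := by
    simp only [Pi.smul_apply, Finset.sum_apply, Pi.mul_apply, Function.comp_apply, Pi.inv_apply,
      smul_eq_mul, Finset.mul_sum]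
    exact Finset.sum_congr rfl fun j _ => by ring
  have hxi := hx i
  rw [hsum, eq_comm, one_div_mul_eq_div, div_eq_iff hf1, mul_right_inj' hxi]

end HellingerDivergence

/-- For a strictly concave `C¹` function `f` on `(0,∞)`, pairwise commuting
positive definite `A₁, …, A_m`, and positive weights summing to `1`, a positive definite `X`
commuting with all `A_j` is a critical point of `X ↦ Σ_j w_j φ_f(A_j, X)` restricted to the
commutative setting (i.e. all directional derivatives along Hermitian directions commuting with
`X` and the `A_j`'s vanish) if and only if `X = (1/f'(1)) Σ_j w_j X f'(A_j⁻¹X)`. -/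
theorem commutative_critical_point_iff {n m : ℕ} (f : ℝ → ℝ)
    (hconc : StrictConcaveOn ℝ (Set.Ioi (0 : ℝ)) f)
    (hC1 : ContDiffOn ℝ 1 f (Set.Ioi (0 : ℝ)))
    (hf1 : deriv f 1 ≠ 0)
    (A : Fin m → Matrix (Fin n) (Fin n) ℂ) (hA : ∀ j, (A j).PosDef)
    (hAcomm : ∀ j k, Commute (A j) (A k))
    (w : Fin m → ℝ) (hw : ∀ j, 0 < w j) (hw1 : ∑ j, w j = 1)
    (X : Matrix (Fin n) (Fin n) ℂ) (hX : X.PosDef) (hXA : ∀ j, Commute (A j) X) :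
    (∀ Y : Matrix (Fin n) (Fin n) ℂ, Y.IsHermitian → (∀ j, Commute (A j) Y) → Commute X Y →
        HasDerivAt (fun t : ℝ => ∑ j, w j * phiF f (A j) (X + t • Y)) 0 0) ↔
      X = (1 / deriv f 1) • ∑ j, w j • (X * cfc (deriv f) ((A j)⁻¹ * X)) := by
  have hf : DifferentiableOn ℝ f (Set.Ioi 0) := hC1.differentiableOn one_ne_zero
  constructor
  · intro hcrit
    let M : Option (Fin m) → Matrix (Fin n) (Fin n) ℂ := fun k => k.elim X A
    obtain ⟨U, d, hd⟩ := exists_forall_eq_conjDiagonal (M := M)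
      (by rintro (_ | j); exacts [hX.isHermitian, (hA j).isHermitian])
      (by rintro (_ | j) (_ | k); exacts [.refl X, (hXA k).symm, hXA j, hAcomm j k])
    obtain rfl : X = conjDiagonal U (d none) := hd none
    obtain rfl : A = fun j => conjDiagonal U (d (some j)) := funext fun j => hd (some j)
    have hx := (posDef_conjDiagonal_iff U _).mp hX
    have ha := fun j => (posDef_conjDiagonal_iff U _).mp (hA j)
    rw [conjDiagonal_eq_smul_sum_iff U hf1 (fun j i => (ha j i).ne') fun i => (hx i).ne']
    intro i
    have h := (hasDerivAt_sum_phiF_conjDiagonal U hf ha hx (Pi.single i 1) hw1).unique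
      (hcrit _ (isHermitian_conjDiagonal U _) (fun _ => commute_conjDiagonal U _ _)
        (commute_conjDiagonal U _ _))
    simp only [Pi.single_apply, ite_mul, one_mul, zero_mul, Finset.sum_ite_eq', Finset.mem_univ,
      if_true] at h
    exact (sub_eq_zero.mp h).symm
  · intro heq Y hY hAY hXY
    let M : Option (Option (Fin m)) → Matrix (Fin n) (Fin n) ℂ := fun k => k.elim Y (·.elim X A)
    obtain ⟨U, d, hd⟩ := exists_forall_eq_conjDiagonal (M := M)
      (by rintro (_ | _ | j); exacts [hY, hX.isHermitian, (hA j).isHermitian])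
      (by
        rintro (_ | _ | j) (_ | _ | k)
        exacts [.refl Y, hXY.symm, (hAY k).symm, hXY, .refl X, (hXA k).symm, hAY j, hXA j,
          hAcomm j k])
    obtain rfl : Y = conjDiagonal U (d none) := hd none
    obtain rfl : X = conjDiagonal U (d (some none)) := hd (some none)
    obtain rfl : A = fun j => conjDiagonal U (d (some (some j))) :=
      funext fun j => hd (some (some j))
    have hx := (posDef_conjDiagonal_iff U _).mp hX
    have ha := fun j => (posDef_conjDiagonal_iff U _).mp (hA j)
    rw [conjDiagonal_eq_smul_sum_iff U hf1 (fun j i => (ha j i).ne') fun i => (hx i).ne'] at heq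
    refine (hasDerivAt_sum_phiF_conjDiagonal U hf ha hx _ hw1).congr_deriv ?_
    exact Finset.sum_eq_zero fun i _ => by rw [heq i, sub_self, mul_zero]
end
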